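/- Let n ≥ 4 be an integer. For 1 ≤ j ≤ ⌊n/2⌋ − 1, define B_j = ∑_{(a,b) : (a,b,j) ∈ E_n^{(1)}∪E_n^{(2)}} θ_{n,(a,b,j)}·A_{n,(a,b,j)}^{(c)}. Then B_j ≤ 2·(j−1)·sin²(πj/n). -/

import Mathlib

/-- `N_{(a,b,c)}`: the number of distinct ordered triples obtained by permuting `(a,b,c)`. -/
def Ntriple (p : ℕ × ℕ × ℕ) : ℕ :=
  ({(p.1, p.2.1, p.2.2), (p.1, p.2.2, p.2.1), (p.2.1, p.1, p.2.2),
    (p.2.1, p.2.2, p.1), (p.2.2, p.1, p.2.1), (p.2.2, p.2.1, p.1)} : Finset (ℕ × ℕ × ℕ)).card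

/-- The weight `θ_{n,(a,b,c)} = N_{(a,b,c)}/3`. -/
noncomputable def thetaTri (p : ℕ × ℕ × ℕ) : ℝ := (Ntriple p : ℝ) / 3

/-- `w_{n,(a,b,c)} = sin²(πa/n) + sin²(πb/n) + sin²(πc/n)`. -/
noncomputable def wTri (n : ℕ) (p : ℕ × ℕ × ℕ) : ℝ :=
  Real.sin (Real.pi * p.1 / n) ^ 2 + Real.sin (Real.pi * p.2.1 / n) ^ 2 +
    Real.sin (Real.pi * p.2.2 / n) ^ 2

/-- `A_{n,(a,b,c)}^{(c)} = w²/(4(sin²(πa/n)+sin²(πb/n)))`. -/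
noncomputable def AcTri (n : ℕ) (p : ℕ × ℕ × ℕ) : ℝ :=
  wTri n p ^ 2 / (4 * (Real.sin (Real.pi * p.1 / n) ^ 2 + Real.sin (Real.pi * p.2.1 / n) ^ 2))

/-- `A_{n,(a,b,c)}^{(b)} = w²/(4(sin²(πa/n)+sin²(πc/n)))`. -/
noncomputable def AbTri (n : ℕ) (p : ℕ × ℕ × ℕ) : ℝ :=
  wTri n p ^ 2 / (4 * (Real.sin (Real.pi * p.1 / n) ^ 2 + Real.sin (Real.pi * p.2.2 / n) ^ 2))

/-- The index set `E_n`: triples `1 ≤ a ≤ b ≤ c ≤ ⌊n/2⌋` with `a+b = c` or `a+b+c = n`.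
For odd `n = 2m+1` this is `E_n^{(1)} ∪ E_n^{(2)}`, and for even `n = 2m` it is
`E_n^{(1)} ∪ E_n^{(2)} ∪ E_n^{(3)}` (triples of `E_n^{(2)}` with `c = m` satisfy `a+b = m = c`
and hence coincide with `E_n^{(3)}`). -/
def Etri (n : ℕ) : Finset (ℕ × ℕ × ℕ) :=
  (Finset.range (n / 2 + 1) ×ˢ Finset.range (n / 2 + 1) ×ˢ Finset.range (n / 2 + 1)).filter
    fun p => 1 ≤ p.1 ∧ p.1 ≤ p.2.1 ∧ p.2.1 ≤ p.2.2 ∧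
      (p.1 + p.2.1 = p.2.2 ∨ p.1 + p.2.1 + p.2.2 = n)

/-- `Q_{n,3}(x) = (1/n³)·∑_{(a,b,c)∈E_n} θ_{n,(a,b,c)}·w_{n,(a,b,c)}·x_a·x_b·x_c`. -/
noncomputable def Q3 (n : ℕ) (x : ℕ → ℝ) : ℝ :=
  (1 / (n : ℝ) ^ 3) * ∑ p ∈ Etri n, thetaTri p * wTri n p * x p.1 * x p.2.1 * x p.2.2

/-- `Q_{n,2}`: for odd `n = 2m+1`, `(2/n²)·∑_{k=1}^{m}(k−1)·sin²(πk/n)·x_k²`; for even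
`n = 2m`, `(2/n²)·∑_{k=1}^{m−1}(k−1)·sin²(πk/n)·x_k² + ((m−1)/n²)·x_m²`. -/
noncomputable def Q2 (n : ℕ) (x : ℕ → ℝ) : ℝ :=
  if n % 2 = 1 then
    (2 / (n : ℝ) ^ 2) * ∑ k ∈ Finset.Icc 1 (n / 2),
      ((k : ℝ) - 1) * Real.sin (Real.pi * k / n) ^ 2 * x k ^ 2
  else
    (2 / (n : ℝ) ^ 2) * ∑ k ∈ Finset.Icc 1 (n / 2 - 1),
      ((k : ℝ) - 1) * Real.sin (Real.pi * k / n) ^ 2 * x k ^ 2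
    + (((n / 2 : ℕ) : ℝ) - 1) / (n : ℝ) ^ 2 * x (n / 2) ^ 2

/-- `Q_{n,4}`: for odd `n = 2m+1`, `(2/n⁴)(∑_{k=1}^m x_k²)(∑_{k=1}^m sin²(πk/n)x_k²)`; for
even `n = 2m`, `(2/n⁴)(∑_{k=1}^{m−1} x_k² + x_m²/2)(∑_{k=1}^{m−1} sin²(πk/n)x_k² + x_m²/2)`. -/
noncomputable def Q4 (n : ℕ) (x : ℕ → ℝ) : ℝ :=
  if n % 2 = 1 then
    (2 / (n : ℝ) ^ 4) * (∑ k ∈ Finset.Icc 1 (n / 2), x k ^ 2) *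
      (∑ k ∈ Finset.Icc 1 (n / 2), Real.sin (Real.pi * k / n) ^ 2 * x k ^ 2)
  else
    (2 / (n : ℝ) ^ 4) * ((∑ k ∈ Finset.Icc 1 (n / 2 - 1), x k ^ 2) + x (n / 2) ^ 2 / 2) *
      ((∑ k ∈ Finset.Icc 1 (n / 2 - 1), Real.sin (Real.pi * k / n) ^ 2 * x k ^ 2)
        + x (n / 2) ^ 2 / 2)

theorem aux_N6 (p : ℕ × ℕ × ℕ) : thetaTri p ≤ 2 := by
  have h : Ntriple p ≤ 6 := Finset.card_le_six
  have : (Ntriple p : ℝ) ≤ 6 := by exact_mod_cast h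
  unfold thetaTri; linarith

theorem aux_N3a (a c : ℕ) : thetaTri (a, a, c) ≤ 1 := by
  have h : Ntriple (a, a, c) ≤ 3 := by
    have : Ntriple (a, a, c) =
        ({(a, a, c), (a, c, a), (c, a, a)} : Finset (ℕ × ℕ × ℕ)).card := by
      unfold Ntriple
      congr 1
      ext x
      simp only [Finset.mem_insert, Finset.mem_singleton]
      tauto
    rw [this]
    exact Finset.card_le_three
  have : (Ntriple (a, a, c) : ℝ) ≤ 3 := by exact_mod_cast h
  unfold thetaTri; linarith

theorem aux_N3b (a c : ℕ) : thetaTri (a, c, c) ≤ 1 := by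
  have h : Ntriple (a, c, c) ≤ 3 := by
    have : Ntriple (a, c, c) =
        ({(a, c, c), (c, a, c), (c, c, a)} : Finset (ℕ × ℕ × ℕ)).card := by
      unfold Ntriple
      congr 1
      ext x
      simp only [Finset.mem_insert, Finset.mem_singleton]
      tauto
    rw [this]
    exact Finset.card_le_three
  have : (Ntriple (a, c, c) : ℝ) ≤ 3 := by exact_mod_cast h
  unfold thetaTri; linarith

theorem aux_N1 (a : ℕ) : thetaTri (a, a, a) = 1 / 3 := by
  simp [thetaTri, Ntriple]

theorem aux_theta_nonneg (p : ℕ × ℕ × ℕ) : 0 ≤ thetaTri p := by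
  unfold thetaTri; positivity

theorem aux_SS (A B : ℝ) : Real.sin A ^ 2 + Real.sin B ^ 2 =
    1 - Real.cos (A + B) * Real.cos (A - B) := by
  rw [Real.cos_add, Real.cos_sub]
  have h1 := Real.sin_sq_add_cos_sq A
  have h2 := Real.sin_sq_add_cos_sq B
  have e1 : Real.cos A ^ 2 = 1 - Real.sin A ^ 2 := by linarith
  have e2 : Real.cos B ^ 2 = 1 - Real.sin B ^ 2 := by linarith
  have : (Real.cos A * Real.cos B - Real.sin A * Real.sin B) *
      (Real.cos A * Real.cos B + Real.sin A * Real.sin B) =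
      Real.cos A ^ 2 * Real.cos B ^ 2 - Real.sin A ^ 2 * Real.sin B ^ 2 := by ring
  rw [this, e1, e2]; ring

theorem aux_frac (S s K : ℝ) (hS : 0 < S) (h : (S - s) ^ 2 ≤ 4 * K * (S * s)) :
    (S + s) ^ 2 / (4 * S) ≤ s * (1 + K) := by
  rw [div_le_iff₀ (by positivity)]
  nlinarith

theorem aux_A1 (A B : ℝ) (hA : 0 < A) (hB : 0 < B) (hAB : A + B < Real.pi / 2) :
    (Real.sin A ^ 2 + Real.sin B ^ 2 + Real.sin (A + B) ^ 2) ^ 2 /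
      (4 * (Real.sin A ^ 2 + Real.sin B ^ 2)) ≤
      Real.sin (A + B) ^ 2 * (1 + Real.cos (A + B) ^ 2 / 4) := by
  have hsA : 0 < Real.sin A := Real.sin_pos_of_pos_of_lt_pi hA (by linarith)
  have hsB : 0 < Real.sin B := Real.sin_pos_of_pos_of_lt_pi hB (by linarith)
  apply aux_frac _ _ _ (by positivity)
  rw [aux_SS, Real.sin_sq (A + B)]
  have hc : 0 < Real.cos (A + B) := Real.cos_pos_of_mem_Ioo ⟨by linarith, by linarith⟩
  have hcy : Real.cos (A + B) ≤ Real.cos (A - B) := by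
    rw [Real.cos_add, Real.cos_sub]; nlinarith [mul_pos hsA hsB]
  have hy : Real.cos (A - B) ≤ 1 := Real.cos_le_one _
  generalize Real.cos (A + B) = c at *
  generalize Real.cos (A - B) = y at *
  have k1 : (y - c) ^ 2 ≤ (1 - c) ^ 2 := by nlinarith
  have k2 : (1 - c) * (1 - c ^ 2) ≤ (1 - c * y) * (1 - c ^ 2) := by
    apply mul_le_mul_of_nonneg_right <;> nlinarith
  have k3 : (1 - c) ^ 2 ≤ (1 - c) * (1 - c ^ 2) := by
    have : 0 ≤ c * (1 - c) ^ 2 := by positivity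
    nlinarith
  have k4 : (y - c) ^ 2 ≤ (1 - c * y) * (1 - c ^ 2) := by linarith
  have := mul_le_mul_of_nonneg_left k4 (sq_nonneg c)
  nlinarith

theorem aux_A2 (A B J : ℝ) (hA : 0 < A) (hA' : A < Real.pi) (hABJ : A + B + J = Real.pi)
    (hc0 : 0 ≤ Real.cos J) (hc : Real.cos J ≤ 1 / 2) :
    (Real.sin A ^ 2 + Real.sin B ^ 2 + Real.sin J ^ 2) ^ 2 /
      (4 * (Real.sin A ^ 2 + Real.sin B ^ 2)) ≤
      Real.sin J ^ 2 * (1 + Real.cos J ^ 2 / 2) := by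
  have hsA : 0 < Real.sin A := Real.sin_pos_of_pos_of_lt_pi hA hA'
  apply aux_frac _ _ _ (by positivity)
  rw [aux_SS, Real.sin_sq J, show A + B = Real.pi - J by linarith, Real.cos_pi_sub]
  have hy : Real.cos (A - B) ≤ 1 := Real.cos_le_one _
  have hy' : -1 ≤ Real.cos (A - B) := Real.neg_one_le_cos _
  generalize Real.cos J = c at *
  generalize Real.cos (A - B) = y at *
  have k1 : y ^ 2 ≤ 1 := by nlinarith
  have c2 : c ^ 2 ≤ 1 / 4 := by nlinarith
  have c3 : c ^ 3 ≤ 1 / 8 := by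
    have : c ^ 3 = c * c ^ 2 := by ring
    nlinarith
  have c30 : 0 ≤ c ^ 3 := by positivity
  have k2 : c ^ 3 * y ≤ c ^ 3 := by nlinarith
  have k4 : (c + y) ^ 2 ≤ 2 * ((1 + c * y) * (1 - c ^ 2)) := by nlinarith
  have := mul_le_mul_of_nonneg_left k4 (sq_nonneg c)
  nlinarith

theorem aux_sum1 (j k : ℕ) (hk : 2 * k ≤ j) (hj : 1 ≤ j) :
    ∑ a ∈ Finset.Icc 1 k, (if 2 * a = j then 1 else 2) ≤ min (2 * k) (j - 1) := by
  induction k with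
  | zero => simp
  | succ k ih =>
    rw [Finset.sum_Icc_succ_top (by omega)]
    have := ih (by omega)
    split_ifs <;> omega

theorem aux_sum2 (N m k : ℕ) (hN : m = (N + 1) / 2) (hk : m ≤ k + 1) :
    ∑ b ∈ Finset.Icc m k, (if 2 * b = N then 1 else 2) ≤ 2 * k + 1 - N := by
  induction k with
  | zero =>
    rcases Nat.eq_zero_or_pos m with h | h
    · subst h; simp; split_ifs <;> omega
    · rw [Finset.Icc_eq_empty (by omega)]; simp
  | succ k ih =>
    by_cases h : m ≤ k + 1
    · rw [Finset.sum_Icc_succ_top h]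
      have := ih h
      split_ifs <;> omega
    · rw [Finset.Icc_eq_empty (by omega)]; simp

theorem aux_T1 (T : Finset (ℕ × ℕ × ℕ)) (j : ℕ) (hj : 1 ≤ j)
    (hT : ∀ p ∈ T, 1 ≤ p.1 ∧ p.1 ≤ p.2.1 ∧ p.2.2 = j ∧ p.1 + p.2.1 = j) :
    ∑ p ∈ T, thetaTri p ≤ (j : ℝ) - 1 := by
  let h : ℕ → ℕ := fun a => if 2 * a = j then 1 else 2
  have h1 : ∑ p ∈ T, thetaTri p ≤ ∑ p ∈ T, (h p.1 : ℝ) := by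
    apply Finset.sum_le_sum
    rintro ⟨a, b, c⟩ hp
    obtain ⟨h1, h2, h3, h4⟩ := hT _ hp
    simp only at h1 h2 h3 h4
    simp only [h]
    split_ifs with hh
    · obtain rfl : b = a := by omega
      simpa using aux_N3a b c
    · simpa using aux_N6 (a, b, c)
  have h2 : ∑ p ∈ T, h p.1 ≤ j - 1 := by
    rw [← Finset.sum_image (f := h) (g := fun p : ℕ × ℕ × ℕ => p.1)]
    · refine le_trans (Finset.sum_le_sum_of_subset (t := Finset.Icc 1 (j / 2)) ?_) ?_
      · intro x hx
        obtain ⟨p, hp, rfl⟩ := Finset.mem_image.1 hx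
        have := hT _ hp
        rw [Finset.mem_Icc]; omega
      · exact le_trans (aux_sum1 j (j / 2) (by omega) hj) (min_le_right _ _)
    · rintro ⟨a, b, c⟩ hp ⟨a', b', c'⟩ hp' he
      have q1 := hT _ hp
      have q2 := hT _ hp'
      simp only at q1 q2 he
      simp only [Prod.mk.injEq]; omega
  have h3 : ((∑ p ∈ T, h p.1 : ℕ) : ℝ) ≤ ((j - 1 : ℕ) : ℝ) := by exact_mod_cast h2
  push_cast [hj] at h3
  linarith

theorem aux_T2 (T : Finset (ℕ × ℕ × ℕ)) (n j : ℕ) (hj : 2 * j < n) (hn : n < 3 * j)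
    (hT : ∀ p ∈ T, 1 ≤ p.1 ∧ p.1 ≤ p.2.1 ∧ p.2.1 ≤ p.2.2 ∧ p.2.2 = j ∧
      p.1 + p.2.1 + p.2.2 = n) :
    ∑ p ∈ T, thetaTri p ≤ 3 * (j : ℝ) - n := by
  let h : ℕ → ℕ := fun b => if b = j then 1 else if 2 * b = n - j then 1 else 2
  have h1 : ∑ p ∈ T, thetaTri p ≤ ∑ p ∈ T, (h p.2.1 : ℝ) := by
    apply Finset.sum_le_sum
    rintro ⟨a, b, c⟩ hp
    obtain ⟨h1, h2, h3, h4, h5⟩ := hT _ hp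
    simp only at h1 h2 h3 h4 h5
    simp only [h]
    split_ifs with hh hh'
    · obtain rfl : b = c := by omega
      simpa using aux_N3b a b
    · obtain rfl : b = a := by omega
      simpa using aux_N3a b c
    · simpa using aux_N6 (a, b, c)
  have h2 : ∑ p ∈ T, h p.2.1 ≤ 3 * j - n := by
    rw [← Finset.sum_image (f := h) (g := fun p : ℕ × ℕ × ℕ => p.2.1)]
    · refine le_trans (Finset.sum_le_sum_of_subset
        (t := Finset.Icc ((n - j + 1) / 2) (j - 1 + 1)) ?_) ?_
      · intro x hx
        obtain ⟨p, hp, rfl⟩ := Finset.mem_image.1 hx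
        have := hT _ hp
        rw [Finset.mem_Icc]; omega
      · rw [Finset.sum_Icc_succ_top (by omega)]
        have e : ∑ b ∈ Finset.Icc ((n - j + 1) / 2) (j - 1), h b =
            ∑ b ∈ Finset.Icc ((n - j + 1) / 2) (j - 1), (if 2 * b = n - j then 1 else 2) := by
          apply Finset.sum_congr rfl
          intro b hb
          rw [Finset.mem_Icc] at hb
          simp only [h]
          rw [if_neg (by omega)]
        have e2 : h (j - 1 + 1) = 1 := by
          simp only [h]; rw [if_pos (by omega)]
        rw [e, e2]
        have := aux_sum2 (n - j) _ (j - 1) rfl (by omega)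
        omega
    · rintro ⟨a, b, c⟩ hp ⟨a', b', c'⟩ hp' he
      have q1 := hT _ hp
      have q2 := hT _ hp'
      simp only at q1 q2 he
      simp only [Prod.mk.injEq]; omega
  have h3 : ((∑ p ∈ T, h p.2.1 : ℕ) : ℝ) ≤ ((3 * j - n : ℕ) : ℝ) := by exact_mod_cast h2
  rw [Nat.cast_sub hn.le] at h3
  push_cast at h3
  linarith

/-- Upper bound for `B_j` (Lemma 4.6): for `n ≥ 4` and `1 ≤ j ≤ ⌊n/2⌋ − 1`,
`B_j = ∑_{(a,b,j) ∈ E_n^{(1)}∪E_n^{(2)}} θ_{n,(a,b,j)}·A_{n,(a,b,j)}^{(c)}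
  ≤ 2(j−1)·sin²(πj/n)`. -/
theorem Bj_upper_bound (n : ℕ) (hn : 4 ≤ n) (j : ℕ) (hj1 : 1 ≤ j) (hj : j ≤ n / 2 - 1) :
    (∑ p ∈ (Etri n).filter fun p => p.2.2 = j, thetaTri p * AcTri n p)
      ≤ 2 * ((j : ℝ) - 1) * Real.sin (Real.pi * j / n) ^ 2 := by
  have hn0 : (0 : ℝ) < n := by exact_mod_cast (by omega : 0 < n)
  have hpi := Real.pi_pos
  have hjn : 2 * j + 2 ≤ n := by omega
  have hjnR : 2 * (j : ℝ) + 2 ≤ n := by exact_mod_cast hjn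
  have hj1R : (1 : ℝ) ≤ j := by exact_mod_cast hj1
  set s : ℝ := Real.sin (Real.pi * j / n) ^ 2 with hs
  set c : ℝ := Real.cos (Real.pi * j / n) with hcdef
  have hs0 : 0 ≤ s := sq_nonneg _
  have hJ : Real.pi * j / n < Real.pi / 2 := by
    rw [div_lt_div_iff₀ hn0 (by norm_num)]; nlinarith
  have hJ0 : 0 < Real.pi * j / n := by positivity
  have hc0 : 0 < c := Real.cos_pos_of_mem_Ioo ⟨by linarith, hJ⟩
  have hc1 : c ≤ 1 := Real.cos_le_one _
  have hmem : ∀ p ∈ (Etri n).filter (fun p => p.2.2 = j), 1 ≤ p.1 ∧ p.1 ≤ p.2.1 ∧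
      p.2.1 ≤ p.2.2 ∧ p.2.2 = j ∧ (p.1 + p.2.1 = p.2.2 ∨ p.1 + p.2.1 + p.2.2 = n) := by
    intro p hp
    rw [Finset.mem_filter, Etri, Finset.mem_filter] at hp
    tauto
  generalize (Etri n).filter (fun p => p.2.2 = j) = T at hmem
  rw [← Finset.sum_filter_add_sum_filter_not T (fun p => p.1 + p.2.1 = j)]
  have hm1 : ∀ p ∈ T.filter (fun p => p.1 + p.2.1 = j),
      1 ≤ p.1 ∧ p.1 ≤ p.2.1 ∧ p.2.2 = j ∧ p.1 + p.2.1 = j := by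
    intro p hp
    rw [Finset.mem_filter] at hp
    have := hmem p hp.1
    omega
  have hm2 : ∀ p ∈ T.filter (fun p => ¬ p.1 + p.2.1 = j),
      1 ≤ p.1 ∧ p.1 ≤ p.2.1 ∧ p.2.1 ≤ p.2.2 ∧ p.2.2 = j ∧ p.1 + p.2.1 + p.2.2 = n := by
    intro p hp
    rw [Finset.mem_filter] at hp
    have := hmem p hp.1
    omega
  generalize T.filter (fun p => p.1 + p.2.1 = j) = T1 at *
  generalize T.filter (fun p => ¬ p.1 + p.2.1 = j) = T2 at *
  have b1 : ∑ p ∈ T1, thetaTri p * AcTri n p ≤ ((j : ℝ) - 1) * (s * (1 + c ^ 2 / 4)) := by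
    refine le_trans (Finset.sum_le_sum (g := fun p => thetaTri p * (s * (1 + c ^ 2 / 4))) ?_) ?_
    · rintro ⟨a, b, k⟩ hp
      obtain ⟨h1, h2, h3, h4⟩ := hm1 _ hp
      simp only at h1 h2 h3 h4
      apply mul_le_mul_of_nonneg_left _ (aux_theta_nonneg _)
      have ha : (0 : ℝ) < a := by exact_mod_cast h1
      have hb : (0 : ℝ) < b := by exact_mod_cast (by omega : 0 < b)
      have hab : (a : ℝ) + b = j := by exact_mod_cast h4
      have e : Real.pi * a / n + Real.pi * b / n = Real.pi * j / n := by
        rw [← hab]; ring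
      have := aux_A1 (Real.pi * a / n) (Real.pi * b / n) (by positivity) (by positivity)
        (by rw [e]; exact hJ)
      rw [e] at this
      simp only [AcTri, wTri, h3]
      exact this
    · rw [← Finset.sum_mul]
      exact mul_le_mul_of_nonneg_right (aux_T1 T1 j hj1 hm1) (by positivity)
  by_cases h3 : n ≤ 3 * j
  · have h3R : (n : ℝ) ≤ 3 * j := by exact_mod_cast h3
    have hc2 : c ≤ 1 / 2 := by
      rw [hcdef, ← Real.cos_pi_div_three]
      apply Real.cos_le_cos_of_nonneg_of_le_pi (by positivity) (by linarith)
      rw [div_le_div_iff₀ (by norm_num) hn0]; nlinarith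
    have b2 : ∀ M : ℝ, ∑ p ∈ T2, thetaTri p ≤ M →
        ∑ p ∈ T2, thetaTri p * AcTri n p ≤ M * (s * (1 + c ^ 2 / 2)) := by
      intro M hM
      refine le_trans (Finset.sum_le_sum
        (g := fun p => thetaTri p * (s * (1 + c ^ 2 / 2))) ?_) ?_
      · rintro ⟨a, b, k⟩ hp
        obtain ⟨h1, h2, h3, h4, h5⟩ := hm2 _ hp
        simp only at h1 h2 h3 h4 h5
        apply mul_le_mul_of_nonneg_left _ (aux_theta_nonneg _)
        have ha : (0 : ℝ) < a := by exact_mod_cast h1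
        have han : (a : ℝ) < n := by exact_mod_cast (by omega : a < n)
        have hab : (a : ℝ) + b + j = n := by exact_mod_cast (by omega : a + b + j = n)
        have e : Real.pi * a / n + Real.pi * b / n + Real.pi * j / n = Real.pi := by
          rw [← add_div, ← add_div, ← mul_add, ← mul_add, hab]; field_simp
        have := aux_A2 (Real.pi * a / n) (Real.pi * b / n) (Real.pi * j / n) (by positivity)
          (by rw [div_lt_iff₀ hn0]; nlinarith) e hc0.le hc2
        simp only [AcTri, wTri, h4]
        exact this
      · rw [← Finset.sum_mul]
        exact mul_le_mul_of_nonneg_right hM (by positivity)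
    have c2 : c ^ 2 ≤ 1 / 4 := by nlinarith
    rcases h3.lt_or_eq with h3' | h3'
    · have b3 := b2 _ (aux_T2 T2 n j (by omega) h3' hm2)
      have key : ((j : ℝ) - 1) * (1 + c ^ 2 / 4) + (3 * j - n) * (1 + c ^ 2 / 2)
          ≤ 2 * ((j : ℝ) - 1) := by
        have hcs : c ≤ Real.pi * (n - 2 * j) / (2 * n) := by
          have e : c = Real.sin (Real.pi * (n - 2 * j) / (2 * n)) := by
            rw [hcdef, ← Real.sin_pi_div_two_sub]
            congr 1
            field_simp
          rw [e]
          apply Real.sin_le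
          apply div_nonneg (mul_nonneg hpi.le (by linarith)) (by positivity)
        have hcn : c * n ≤ 2 * (n - 2 * j) := by
          rw [le_div_iff₀ (by positivity)] at hcs
          nlinarith [Real.pi_le_four]
        have hccn : c ^ 2 * n ≤ (n - 2 * j) := by nlinarith
        have q1 : c ^ 2 * ((j : ℝ) - 1) ≤ c ^ 2 * (n / 2) :=
          mul_le_mul_of_nonneg_left (by linarith) (sq_nonneg c)
        have q2 : c ^ 2 * (3 * (j : ℝ) - n) ≤ c ^ 2 * (n / 2) :=
          mul_le_mul_of_nonneg_left (by linarith) (sq_nonneg c)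
        nlinarith
      have := mul_le_mul_of_nonneg_right key hs0
      nlinarith
    · have b3 := b2 (1 / 3) (by
        have hsub : T2 ⊆ {(j, j, j)} := by
          rintro ⟨a, b, k⟩ hp
          have := hm2 _ hp
          simp only at this
          rw [Finset.mem_singleton, Prod.mk.injEq, Prod.mk.injEq]
          omega
        refine le_trans (Finset.sum_le_sum_of_subset_of_nonneg hsub
          (fun p _ _ => aux_theta_nonneg p)) ?_
        rw [Finset.sum_singleton, aux_N1])
      have hj2 : (2 : ℝ) ≤ j := by exact_mod_cast (by omega : 2 ≤ j)
      have key : ((j : ℝ) - 1) * (1 + c ^ 2 / 4) + (1 / 3) * (1 + c ^ 2 / 2)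
          ≤ 2 * ((j : ℝ) - 1) := by nlinarith
      have := mul_le_mul_of_nonneg_right key hs0
      nlinarith
  · have hE : T2 = ∅ := by
      rw [Finset.eq_empty_iff_forall_notMem]
      intro p hp
      have := hm2 p hp
      omega
    rw [hE, Finset.sum_empty, add_zero]
    have c2 : c ^ 2 ≤ 1 := by nlinarith
    have key : ((j : ℝ) - 1) * (1 + c ^ 2 / 4) ≤ 2 * ((j : ℝ) - 1) := by nlinarith
    have := mul_le_mul_of_nonneg_right key hs0
    nlinarith
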